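/- arXiv:math/0501420 — 3 statements merged into one kernel-verified Lean document; each statement's English description precedes it below -/
import Mathlib

section
/- Let 𝒟 = {δ(w) : w an infinite word on ℕ}, 𝒟₀ = {δ(w) : w an infinite word on ℕ with abundant palindromic prefixes}, and 𝒟' the union of {δ(w) : w a periodic infinite word on ℕ whose period is a nonempty palindrome, i.e. w(n) = p(n mod |p|) for all n for some nonempty palindrome p} and {δ(c) : c a characteristic Sturmian word on the two letters 0, 1}. Then 𝒟' ∩ [1,√3] = 𝒟₀ ∩ [1,√3] = 𝒟 ∩ [1,√3]. -/
open Filter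
open scoped Classical

/-- The prefix of length `n` of the infinite word `w`. -/
def pref {A : Type*} (w : ℕ → A) (n : ℕ) : List A := (List.range n).map w

/-- The predicate "the prefix of `w` of length `n` is a palindrome". -/
def palP {A : Type*} (w : ℕ → A) : ℕ → Prop := fun n => (pref w n).Palindrome

/-- `δ(w)`: the limsup of quotients of consecutive lengths of palindromic prefixes of `w`,
or `⊤` if `w` has only finitely many palindromic prefixes. -/
noncomputable def delta {A : Type*} (w : ℕ → A) : ENNReal :=
  if (setOf (palP w)).Infinite then
    limsup (fun i => (Nat.nth (palP w) (i + 1) : ENNReal) / (Nat.nth (palP w) i : ENNReal)) atTop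
  else ⊤

/-- `w` has abundant palindromic prefixes. -/
def Abundant {A : Type*} (w : ℕ → A) : Prop :=
  (setOf (palP w)).Infinite ∧
    ∀ i, Nat.nth (palP w) (i + 1) ≤ 2 * Nat.nth (palP w) i + 1

/-- `w` is periodic with a nonempty palindromic period. -/
def PerPal (w : ℕ → ℕ) : Prop :=
  ∃ p : List ℕ, p ≠ [] ∧ p.Palindrome ∧ ∀ n, w n = p.getD (n % p.length) 0

/-- The `n`-th standard word `σ_n` built on letters `a`, `b` from the sequence `s`
(`s k` is `s_{k+1}` of the paper): `σ_0 = a`, `σ_1 = a^{s_1 - 1} b`,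
`σ_n = σ_{n-1}^{s_n} σ_{n-2}`. -/
def sigmaW {A : Type*} (a b : A) (s : ℕ → ℕ) : ℕ → List A
  | 0 => [a]
  | 1 => List.replicate (s 0 - 1) a ++ [b]
  | (n + 2) => (List.replicate (s (n + 1)) (sigmaW a b s (n + 1))).flatten ++ sigmaW a b s n

/-- `c` is the characteristic Sturmian word on the letters `0`, `1` with slope
`[0, s_1, s_2, ...]` for some sequence of positive integers `(s_k)`: every standard
word `σ_n` (`n ≥ 1`) is a prefix of `c`. -/
def IsCharSturmian (c : ℕ → ℕ) : Prop :=
  ∃ s : ℕ → ℕ, (∀ k, 0 < s k) ∧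
    ∀ n ≥ 1, pref c (sigmaW 0 1 s n).length = sigmaW 0 1 s n


lemma palP_iff {w : ℕ → ℕ} {m : ℕ} : palP w m ↔ ∀ i, i < m → w i = w (m - 1 - i) := by
  unfold palP pref
  rw [List.Palindrome.iff_reverse_eq] 
  constructor
  · intro h i hi
    have h2 : ((List.range m).map w).reverse[i]'(by simpa using hi) =
        ((List.range m).map w)[i]'(by simpa using hi) := by
      simp only [h]
    simp at h2
    exact h2.symm
  · intro h
    apply List.ext_getElem
    · simp
    · intro i h1 h2
      simp at h1 h2 ⊢
      exact (h i h1).symm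

/-- two palindromic prefixes give a period -/
lemma pal_period {w : ℕ → ℕ} {m n : ℕ} (hm : palP w m) (hn : palP w n) (hmn : m ≤ n) :
    ∀ x, x < m → w (x + (n - m)) = w x := by
  intro x hx
  rw [palP_iff] at hm hn
  rw [hn _ (by omega), hm x hx]
  congr 1; omega

lemma pal_of_period {w : ℕ → ℕ} {m n : ℕ} (hn : palP w n) (hmn : m ≤ n)
    (h : ∀ x, x < m → w (x + (n - m)) = w x) : palP w m := by
  rw [palP_iff] at hn ⊢
  intro i hi
  rw [← h i hi, hn _ (by omega)]
  congr 1; omega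

/-- reflection: `2m - n` -/
lemma pal_refl {w : ℕ → ℕ} {m n : ℕ} (hm : palP w m) (hn : palP w n) (hmn : m ≤ n)
    (h2 : n ≤ 2 * m) : palP w (2 * m - n) := by
  apply pal_of_period hm (by omega)
  intro x hx
  have := pal_period hm hn hmn x (by omega)
  rw [show m - (2 * m - n) = n - m by omega]
  exact this

def Bd (w : ℕ → ℕ) (y : ℝ) : Prop :=
  ∃ M : ℕ, ∀ n, palP w n → M ≤ n → ∃ n', palP w n' ∧ n < n' ∧ (n' : ℝ) ≤ y * n

lemma nth_succ_le {w : ℕ → ℕ} (hinf : (setOf (palP w)).Infinite) {i n' : ℕ} (h : palP w n')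
    (hlt : Nat.nth (palP w) i < n') : Nat.nth (palP w) (i + 1) ≤ n' := by
  by_contra hc
  push Not at hc
  have := Nat.lt_nth_iff_count_lt hinf (a := i+1) (b := n')
  rw [← Nat.nth_count h] at hlt hc
  have h1 := (Nat.nth_lt_nth hinf).1 hlt
  have h2 := (Nat.nth_lt_nth hinf).1 hc
  omega

lemma delta_A {w : ℕ → ℕ} {y : ℝ} (hy : 0 < y) (h : delta w < ENNReal.ofReal y) :
    (setOf (palP w)).Infinite ∧ Bd w y := by
  unfold delta at h
  split_ifs at h with hinf
  · refine ⟨hinf, ?_⟩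
    have := Filter.eventually_lt_of_limsup_lt h
    obtain ⟨M, hM⟩ := eventually_atTop.1 this
    refine ⟨Nat.nth (palP w) (M + 1), fun n hn hMn => ?_⟩
    set i := Nat.count (palP w) n with hi
    have hni : Nat.nth (palP w) i = n := Nat.nth_count hn
    have hiM : M + 1 ≤ i := by
      rw [← hni] at hMn
      exact (Nat.nth_le_nth hinf).1 hMn
    have hlt : n < Nat.nth (palP w) (i + 1) := by
      conv_lhs => rw [← hni]
      exact (Nat.nth_lt_nth hinf).2 (Nat.lt_succ_self i)
    refine ⟨Nat.nth (palP w) (i + 1), Nat.nth_mem_of_infinite hinf _, hlt, ?_⟩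
    have h3 := (hM i (by omega)).le
    rw [hni] at h3
    have hn0 : 0 < n := by
      rw [← hni]
      have := (Nat.nth_lt_nth hinf (k := 0) (n := i)).2 (by omega)
      omega
    rw [ENNReal.div_le_iff (by simpa using hn0.ne') (by simp)] at h3
    have h4 := ENNReal.toReal_mono (by finiteness) h3
    simpa [ENNReal.toReal_ofReal hy.le] using h4
  · exact absurd h (by simp)

lemma delta_B {w : ℕ → ℕ} {y : ℝ} (hinf : (setOf (palP w)).Infinite) (h : Bd w y) :
    delta w ≤ ENNReal.ofReal y := by
  unfold delta
  rw [if_pos hinf]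
  obtain ⟨M, hM⟩ := h
  apply Filter.limsup_le_of_le
  · isBoundedDefault
  filter_upwards [eventually_ge_atTop (M + 1)] with i hi
  have hid : ∀ j, j ≤ Nat.nth (palP w) j := fun j => (Nat.nth_strictMono hinf).le_apply
  obtain ⟨n', h1, h2, h3⟩ := hM (Nat.nth (palP w) i) (Nat.nth_mem_of_infinite hinf _)
    (by have := hid i; omega)
  have h4 := nth_succ_le hinf h1 h2
  have hn0 : 0 < Nat.nth (palP w) i := by have := hid i; omega
  rw [ENNReal.div_le_iff (by simpa using hn0.ne') (by simp)]
  have h5 : ((Nat.nth (palP w) (i+1) : ℕ) : ℝ) ≤ y * (Nat.nth (palP w) i : ℕ) :=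
    le_trans (by exact_mod_cast h4) h3
  have h6 := ENNReal.ofReal_le_ofReal h5
  rw [ENNReal.ofReal_mul' (by positivity)] at h6
  simpa using h6

lemma one_le_delta (w : ℕ → ℕ) : 1 ≤ delta w := by
  by_contra hc
  push Not at hc
  rw [← ENNReal.ofReal_one] at hc
  obtain ⟨hinf, M, hM⟩ := delta_A one_pos hc
  obtain ⟨n, hn, hMn⟩ := hinf.exists_gt M
  obtain ⟨n', _, h2, h3⟩ := hM n hn hMn.le
  rw [one_mul] at h3
  have : n' ≤ n := by exact_mod_cast h3
  omega

lemma delta_le_of {w : ℕ → ℕ} {x : ℝ} (hinf : (setOf (palP w)).Infinite)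
    (h : ∀ y, x < y → Bd w y) : delta w ≤ ENNReal.ofReal x := by
  apply le_of_forall_gt_imp_ge_of_dense
  intro a ha
  rcases eq_or_ne a ⊤ with rfl | hat
  · exact le_top
  obtain ⟨b, hb⟩ : ∃ b : ℝ, b = a.toReal := ⟨_, rfl⟩
  have hab : a = ENNReal.ofReal b := by rw [hb, ENNReal.ofReal_toReal hat]
  rw [hab] at ha ⊢
  exact delta_B hinf (h b (ENNReal.ofReal_lt_ofReal_iff'.1 ha).1)

/-- arbitrarily large palindromes with bounded gaps -/
lemma delta_eq_one {w : ℕ → ℕ} (hinf : (setOf (palP w)).Infinite) (p M : ℕ)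
    (h : ∀ n, palP w n → M ≤ n → ∃ n', palP w n' ∧ n < n' ∧ n' ≤ n + p) : delta w = 1 := by
  apply le_antisymm _ (one_le_delta w)
  rw [← ENNReal.ofReal_one]
  apply delta_le_of hinf
  intro y hy
  obtain ⟨K, hK⟩ := exists_nat_gt (p / (y - 1))
  refine ⟨M + K, fun n hn hMn => ?_⟩
  obtain ⟨n', h1, h2, h3⟩ := h n hn (by omega)
  refine ⟨n', h1, h2, ?_⟩
  have h4 : (n' : ℝ) ≤ n + p := by exact_mod_cast h3
  have h5 : (K : ℝ) ≤ n := by exact_mod_cast (by omega : K ≤ n)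
  rw [div_lt_iff₀ (by linarith)] at hK
  nlinarith

lemma pal_const (m : ℕ) : palP (fun _ : ℕ => (0 : ℕ)) m := by
  rw [palP_iff]; intros; rfl

lemma delta_const : delta (fun _ : ℕ => (0 : ℕ)) = 1 := by
  apply delta_eq_one (p := 1) (M := 0)
  · rw [show setOf (palP (fun _ : ℕ => (0 : ℕ))) = Set.univ from Set.eq_univ_of_forall pal_const]
    exact Set.infinite_univ
  · intro n _ _
    exact ⟨n + 1, pal_const _, by omega, by omega⟩

lemma abundant_of {w : ℕ → ℕ} (hinf : (setOf (palP w)).Infinite)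
    (h : ∀ n, palP w n → ∃ n', palP w n' ∧ n < n' ∧ n' ≤ 2 * n + 1) : Abundant w := by
  refine ⟨hinf, fun i => ?_⟩
  obtain ⟨n', h1, h2, h3⟩ := h _ (Nat.nth_mem_of_infinite hinf i)
  exact (nth_succ_le hinf h1 h2).trans h3

lemma infinite_of_step {w : ℕ → ℕ}
    (h : ∀ n, palP w n → ∃ n', palP w n' ∧ n < n') : (setOf (palP w)).Infinite := by
  have h0 : palP w 0 := by rw [palP_iff]; intro i hi; omega
  apply Set.infinite_of_not_bddAbove
  rintro ⟨B, hB⟩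
  have : ∀ k, ∃ n, palP w n ∧ k ≤ n := by
    intro k
    induction k with
    | zero => exact ⟨0, h0, le_rfl⟩
    | succ k ih =>
      obtain ⟨n, hn, hk⟩ := ih
      obtain ⟨n', h1, h2⟩ := h n hn
      exact ⟨n', h1, by omega⟩
  obtain ⟨n, hn, hk⟩ := this (B + 1)
  have := hB hn
  omega

lemma abundant_const : Abundant (fun _ : ℕ => (0 : ℕ)) := by
  apply abundant_of
  · exact infinite_of_step (fun n _ => ⟨n + 1, pal_const _, by omega⟩)
  · exact fun n _ => ⟨n + 1, pal_const _, by omega, by omega⟩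

lemma perPal_const : PerPal (fun _ : ℕ => (0 : ℕ)) := by
  refine ⟨[0], by simp, List.Palindrome.singleton 0, fun n => ?_⟩
  simp [Nat.mod_one]

lemma delta_perPal {w : ℕ → ℕ} (h : PerPal w) : delta w = 1 := by
  obtain ⟨p, hp, hpal, hw⟩ := h
  have hL : 0 < p.length := List.length_pos_iff.2 hp
  have hrev : ∀ i, i < p.length → p.getD i 0 = p.getD (p.length - 1 - i) 0 := by
    intro i hi
    have h1 := List.Palindrome.iff_reverse_eq.1 hpal
    conv_lhs => rw [← h1]
    rw [List.getD_eq_getElem _ _ (by simpa using hi), List.getD_eq_getElem _ _ (by omega)]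
    simp
  have hmul : ∀ k, palP w (k * p.length) := by
    intro k
    rw [palP_iff]
    intro i hi
    rw [hw, hw, hrev _ (Nat.mod_lt _ hL)]
    congr 1
    have e1 := Nat.div_add_mod i p.length
    have e2 := Nat.mod_lt i hL
    have e3 : i / p.length < k := (Nat.div_lt_iff_lt_mul hL).2 hi
    obtain ⟨r, hr⟩ := Nat.exists_eq_add_of_lt e3
    have : k * p.length - 1 - i = (p.length - 1 - i % p.length) + p.length * r := by
      have : k * p.length = p.length * (i / p.length) + p.length * r + p.length := by
        rw [hr]; ring
      omega
    rw [this, Nat.add_mul_mod_self_left,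
      Nat.mod_eq_of_lt (a := p.length - 1 - i % p.length) (by omega)]
  have hnext : ∀ n, ∃ n', palP w n' ∧ n < n' ∧ n' ≤ n + p.length := by
    intro n
    refine ⟨(n / p.length + 1) * p.length, hmul _, ?_, ?_⟩
    · have e1 := Nat.div_add_mod n p.length
      have e2 := Nat.mod_lt n hL
      rw [Nat.add_mul, Nat.mul_comm]; omega
    · have := Nat.div_mul_le_self n p.length
      rw [Nat.add_mul]; omega
  exact delta_eq_one (infinite_of_step fun n _ => by
    obtain ⟨n', a, b, _⟩ := hnext n; exact ⟨n', a, b⟩) p.length 0 (fun n _ _ => hnext n)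

structure Ladder (w : ℕ → ℕ) (m D N : ℕ → ℕ) (C : ℤ) : Prop where
  Dpos : ∀ k, 0 < D k
  rec' : ∀ k, D (k + 2) = m k * D (k + 1) + D k
  mpos : ∀ k, 0 < m k
  hN : ∀ k, (N k : ℤ) = D (k + 1) + D k + C
  mem : ∀ k, palP w (N k)
  gap : ∀ k n, palP w n → N k < n → N k + D (k + 1) ≤ n
  cover : ∀ K n, palP w n → N K ≤ n → ∃ k, K ≤ k ∧ N k ≤ n ∧ palP w (n + D (k + 1))

lemma rec_ge {m D : ℕ → ℕ} (hD : ∀ k, 0 < D k) (hr : ∀ k, D (k + 2) = m k * D (k + 1) + D k)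
    (hm : ∀ k, 0 < m k) : ∀ k, k ≤ D (k + 1) := by
  intro k
  induction k with
  | zero => exact (hD 1).le
  | succ k ih =>
    rw [hr]
    have := hD k
    have : 1 * D (k + 1) ≤ m k * D (k + 1) := Nat.mul_le_mul_right _ (hm k)
    omega

namespace Ladder
variable {w : ℕ → ℕ} {m D N : ℕ → ℕ} {C : ℤ}

lemma Dge (h : Ladder w m D N C) (k : ℕ) : k ≤ D (k + 1) := rec_ge h.Dpos h.rec' h.mpos k

lemma N_large (h : Ladder w m D N C) (M : ℕ) : ∃ K, ∀ k, K ≤ k → M ≤ N k := by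
  refine ⟨M + C.natAbs, fun k hk => ?_⟩
  have h1 := h.hN k
  have h2 := h.Dge k
  omega

lemma inf (h : Ladder w m D N C) : (setOf (palP w)).Infinite := by
  apply Set.infinite_of_not_bddAbove
  rintro ⟨B, hB⟩
  obtain ⟨K, hK⟩ := h.N_large (B + 1)
  have h1 := hK K le_rfl
  have h2 := hB (h.mem K)
  omega

lemma bd_to (h : Ladder w m D N C) {y : ℝ} (hb : Bd w y) :
    ∃ K, ∀ k, K ≤ k → 1 ≤ (y - 1) * (N k / D (k + 1)) := by
  obtain ⟨M, hM⟩ := hb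
  obtain ⟨K, hK⟩ := h.N_large M
  refine ⟨K, fun k hk => ?_⟩
  obtain ⟨n', h1, h2, h3⟩ := hM _ (h.mem k) (hK k hk)
  have h4 : ((N k : ℕ) : ℝ) + D (k + 1) ≤ n' := by exact_mod_cast h.gap k n' h1 h2
  have hD : (0 : ℝ) < D (k + 1) := by exact_mod_cast h.Dpos _
  rw [← mul_div_assoc, le_div_iff₀ hD]
  linarith

lemma to_bd (h : Ladder w m D N C) {y : ℝ}
    (hb : ∃ K, ∀ k, K ≤ k → 1 ≤ (y - 1) * ((N k : ℝ) / D (k + 1))) : Bd w y := by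
  obtain ⟨K, hK⟩ := hb
  refine ⟨N K, fun n hn hKn => ?_⟩
  obtain ⟨k, hk, h1, h2⟩ := h.cover K n hn hKn
  refine ⟨_, h2, by have := h.Dpos (k + 1); omega, ?_⟩
  have h3 := hK k hk
  have hD : (0 : ℝ) < D (k + 1) := by exact_mod_cast h.Dpos _
  rw [← mul_div_assoc, le_div_iff₀ hD] at h3
  have h4 : (N k : ℝ) ≤ n := by exact_mod_cast h1
  have h5 : (0 : ℝ) ≤ N k := by positivity
  have hy : 0 ≤ y - 1 := by
    by_contra hc
    push Not at hc
    nlinarith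
  push_cast
  nlinarith

lemma ratio (h : Ladder w m D N C) (k : ℕ) :
    (N k : ℝ) / D (k + 1) = 1 + (D k : ℝ) / D (k + 1) + C / D (k + 1) := by
  have h1 : ((N k : ℕ) : ℝ) = D (k + 1) + D k + C := by exact_mod_cast h.hN k
  have hD : (0 : ℝ) < D (k + 1) := by exact_mod_cast h.Dpos _
  rw [h1]; field_simp

lemma tendstoD (h : Ladder w m D N C) : Tendsto (fun k => (D (k + 1) : ℝ)) atTop atTop := by
  apply tendsto_atTop_mono (f := fun k : ℕ => (k : ℝ))
  · intro k; exact_mod_cast h.Dge k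
  · exact tendsto_natCast_atTop_atTop

lemma tendstoC (h : Ladder w m D N C) (c : ℝ) :
    Tendsto (fun k => c / (D (k + 1) : ℝ)) atTop (nhds 0) :=
  h.tendstoD.const_div_atTop c

lemma diff {w' : ℕ → ℕ} {D' N' : ℕ → ℕ} {C' : ℤ} (h : Ladder w m D N C)
    (h' : Ladder w' m D' N' C') :
    Tendsto (fun k => (N k : ℝ) / D (k + 1) - (N' k : ℝ) / D' (k + 1)) atTop (nhds 0) := by
  have hdet : ∀ k, |(D k : ℝ) * D' (k + 1) - D' k * D (k + 1)|
      = |(D 0 : ℝ) * D' 1 - D' 0 * D 1| := by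
    intro k
    induction k with
    | zero => rfl
    | succ k ih =>
      rw [← ih, ← abs_neg]
      rw [h.rec' k, h'.rec' k]
      push_cast
      congr 1; ring
  set E := |(D 0 : ℝ) * D' 1 - D' 0 * D 1|
  have hx : Tendsto (fun k => (D k : ℝ) / D (k + 1) - (D' k : ℝ) / D' (k + 1)) atTop (nhds 0) := by
    apply squeeze_zero_norm (a := fun k => E / (D (k + 1) : ℝ)) _ (h.tendstoC E)
    intro k
    have hD : (0 : ℝ) < D (k + 1) := by exact_mod_cast h.Dpos _
    have hD' : (1 : ℝ) ≤ D' (k + 1) := by exact_mod_cast h'.Dpos _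
    rw [Real.norm_eq_abs, div_sub_div _ _ hD.ne' (by positivity), abs_div,
      show (D k : ℝ) * D' (k + 1) - D (k + 1) * D' k = D k * D' (k + 1) - D' k * D (k + 1) by ring,
      hdet k, abs_of_pos (by positivity)]
    apply div_le_div_of_nonneg_left (abs_nonneg _) hD
    nlinarith
  have := (hx.add (h.tendstoC C)).sub (h'.tendstoC C')
  simp only [add_zero, sub_zero] at this
  refine this.congr fun k => ?_
  rw [h.ratio, h'.ratio]; ring

lemma compare {w' : ℕ → ℕ} {D' N' : ℕ → ℕ} {C' : ℤ} (h : Ladder w m D N C)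
    (h' : Ladder w' m D' N' C') {y y' : ℝ} (hyy : y < y') (hb : Bd w y) : Bd w' y' := by
  apply h'.to_bd
  obtain ⟨K, hK⟩ := h.bd_to hb
  have hy : 0 < y - 1 := by
    have h1 := hK K le_rfl
    by_contra hc
    push Not at hc
    have : (0 : ℝ) ≤ N K / D (K + 1) := by positivity
    nlinarith
  have hε : 0 < 1 / (y - 1) - 1 / (y' - 1) := by
    rw [sub_pos]
    exact one_div_lt_one_div_of_lt hy (by linarith)
  obtain ⟨K', hK'⟩ := eventually_atTop.1 ((h.diff h').eventually_lt_const hε)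
  refine ⟨max K K', fun k hk => ?_⟩
  have h1 := hK k (le_trans (le_max_left _ _) hk)
  have h2 := hK' k (le_trans (le_max_right _ _) hk)
  rw [mul_comm, ← div_le_iff₀ hy] at h1
  rw [mul_comm, ← div_le_iff₀ (by linarith)]
  linarith

lemma delta_le {w' : ℕ → ℕ} {D' N' : ℕ → ℕ} {C' : ℤ} (h : Ladder w m D N C)
    (h' : Ladder w' m D' N' C') (hf : delta w ≠ ⊤) : delta w' ≤ delta w := by
  have hd : delta w = ENNReal.ofReal (delta w).toReal := (ENNReal.ofReal_toReal hf).symm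
  rw [hd]
  apply delta_le_of h'.inf
  intro y hy
  obtain ⟨y₁, hy1, hy2⟩ := exists_between hy
  have hpos : 0 < y₁ := lt_of_le_of_lt ENNReal.toReal_nonneg hy1
  have : delta w < ENNReal.ofReal y₁ := by
    conv_lhs => rw [hd]
    exact (ENNReal.ofReal_lt_ofReal_iff hpos).2 hy1
  exact h.compare h' hy2 (delta_A hpos this).2

lemma delta_eq {w' : ℕ → ℕ} {D' N' : ℕ → ℕ} {C' : ℤ} (h : Ladder w m D N C)
    (h' : Ladder w' m D' N' C') (hf : delta w ≠ ⊤) : delta w' = delta w := by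
  have h1 := h.delta_le h' hf
  exact le_antisymm h1 (h'.delta_le h (ne_top_of_le_ne_top hf h1))

end Ladder

/-- the ladder with quotients 2,1,2,1,... has delta `√3` -/
lemma delta_sqrt3 {w D N : ℕ → ℕ} {C : ℤ}
    (h : Ladder w (fun k => if Even k then 2 else 1) D N C) :
    delta w = ENNReal.ofReal (Real.sqrt 3) := by
  set r := Real.sqrt 3 with hr
  have hr2 : r * r = 3 := Real.mul_self_sqrt (by norm_num)
  have hr0 : 0 ≤ r := Real.sqrt_nonneg 3
  have hr1 : 1.7 < r := by nlinarith
  have hr3 : r < 1.8 := by nlinarith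
  -- limits
  set xs : ℕ → ℝ := fun k => if Even k then r - 1 else (r - 1) / 2 with hxs
  have hxrec : ∀ k, xs (k + 1) * ((if Even k then 2 else 1 : ℕ) + xs k) = 1 := by
    intro k
    simp only [hxs, Nat.even_add_one]
    by_cases hk : Even k
    · simp [hk]; nlinarith
    · simp [hk]; nlinarith
  have hx0 : ∀ k, 0 ≤ xs k ∧ xs k ≤ 1 ∧ (r - 1) / 2 ≤ xs k := by
    intro k
    simp only [hxs]
    split_ifs <;> refine ⟨?_, ?_, ?_⟩ <;> linarith
  have he : ∀ k, |(D k : ℝ) - xs k * D (k + 1)| ≤ |(D 0 : ℝ) - xs 0 * D 1| := by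
    intro k
    induction k with
    | zero => exact le_rfl
    | succ k ih =>
      refine le_trans ?_ ih
      have e : (D (k + 1) : ℝ) - xs (k + 1) * D (k + 1 + 1)
          = - xs (k + 1) * (D k - xs k * D (k + 1)) := by
        have := hxrec k
        rw [h.rec' k]; push_cast at this ⊢
        linear_combination (-(D (k+1) : ℝ)) * this
      rw [e, abs_mul, abs_neg, abs_of_nonneg (hx0 _).1]
      exact mul_le_of_le_one_left (abs_nonneg _) (hx0 _).2.1
  set E := |(D 0 : ℝ) - xs 0 * D 1|
  have hz : Tendsto (fun k => (N k : ℝ) / D (k + 1) - (1 + xs k)) atTop (nhds 0) := by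
    have hx : Tendsto (fun k => (D k : ℝ) / D (k + 1) - xs k) atTop (nhds 0) := by
      apply squeeze_zero_norm (a := fun k => E / (D (k + 1) : ℝ)) _ (h.tendstoC E)
      intro k
      have hD : (0 : ℝ) < D (k + 1) := by exact_mod_cast h.Dpos _
      rw [Real.norm_eq_abs, div_sub' hD.ne', abs_div, abs_of_pos hD, mul_comm]
      gcongr
      exact he k
    have := hx.add (h.tendstoC C)
    simp only [add_zero] at this
    refine this.congr fun k => ?_
    rw [h.ratio]; ring
  apply le_antisymm
  · apply delta_le_of h.inf
    intro y hy
    apply h.to_bd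
    have hε : - ((r + 1) / 2 - 1 / (y - 1)) < 0 := by
      have : 1 / (y - 1) < 1 / (r - 1) := one_div_lt_one_div_of_lt (by linarith) (by linarith)
      have e : 1 / (r - 1) = (r + 1) / 2 := by
        rw [div_eq_div_iff (by linarith) (by norm_num)]; linarith
      linarith
    obtain ⟨K, hK⟩ := eventually_atTop.1 (hz.eventually_const_lt hε)
    refine ⟨K, fun k hk => ?_⟩
    have h1 := hK k hk
    rw [mul_comm, ← div_le_iff₀ (by linarith)]
    linarith [(hx0 k).2.2]
  · by_contra hc
    push Not at hc
    obtain ⟨a, ha1, ha2⟩ := exists_between hc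
    have hat : a ≠ ⊤ := ne_top_of_lt ha2
    obtain ⟨y, hy⟩ : ∃ y : ℝ, y = a.toReal := ⟨_, rfl⟩
    have hay : a = ENNReal.ofReal y := by rw [hy, ENNReal.ofReal_toReal hat]
    rw [hay] at ha1 ha2
    have hyr := (ENNReal.ofReal_lt_ofReal_iff'.1 ha2).1
    have hy0 : 0 < y := ENNReal.ofReal_pos.1 (lt_of_le_of_lt bot_le ha1)
    obtain ⟨K, hK⟩ := h.bd_to (delta_A hy0 ha1).2
    have hy1 : 0 < y - 1 := by
      have h1 := hK K le_rfl
      by_contra hc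
      push Not at hc
      have : (0 : ℝ) ≤ N K / D (K + 1) := by positivity
      nlinarith
    have hε : 0 < 1 / (y - 1) - (r + 1) / 2 := by
      have : 1 / (r - 1) < 1 / (y - 1) := one_div_lt_one_div_of_lt (by linarith) (by linarith)
      have e : 1 / (r - 1) = (r + 1) / 2 := by
        rw [div_eq_div_iff (by linarith) (by norm_num)]; linarith
      linarith
    obtain ⟨K', hK'⟩ := eventually_atTop.1 (hz.eventually_lt_const hε)
    have h1 := hK (2 * (K + K') + 1) (by omega)
    have h2 := hK' (2 * (K + K') + 1) (by omega)
    have h3 : xs (2 * (K + K') + 1) = (r - 1) / 2 := by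
      simp only [hxs]; rw [if_neg]; simp
    rw [h3] at h2
    rw [mul_comm, ← div_le_iff₀ hy1] at h1
    linarith

def pw (v : List ℕ) (t : ℕ) : List ℕ := (List.replicate t v).flatten

lemma pw_zero (v : List ℕ) : pw v 0 = [] := rfl
lemma pw_succ (v : List ℕ) (t : ℕ) : pw v (t + 1) = v ++ pw v t := by
  simp [pw, List.replicate_succ]
lemma pw_add (v : List ℕ) (a b : ℕ) : pw v (a + b) = pw v a ++ pw v b := by
  rw [pw, pw, pw, List.replicate_add, List.flatten_append]
lemma pw_one (v : List ℕ) : pw v 1 = v := by simp [pw]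
lemma pw_succ' (v : List ℕ) (t : ℕ) : pw v (t + 1) = pw v t ++ v := by
  rw [pw_add, pw_one]
lemma pw_reverse (v : List ℕ) (t : ℕ) : (pw v t).reverse = pw v.reverse t := by
  induction t with
  | zero => rfl
  | succ t ih => rw [pw_succ, List.reverse_append, ih, pw_succ']
lemma pw_length (v : List ℕ) (t : ℕ) : (pw v t).length = t * v.length := by
  induction t with
  | zero => simp [pw_zero]
  | succ t ih => rw [pw_succ, List.length_append, ih]; ring
lemma pw_comm {v u v' : List ℕ} (h : v ++ u = u ++ v') (t : ℕ) : pw v t ++ u = u ++ pw v' t := by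
  induction t with
  | zero => simp [pw_zero]
  | succ t ih => rw [pw_succ, List.append_assoc, ih, ← List.append_assoc, h, List.append_assoc, ← pw_succ]

abbrev sg (s : ℕ → ℕ) (n : ℕ) : List ℕ := sigmaW 0 1 s n

lemma sg_rec (s : ℕ → ℕ) (n : ℕ) : sg s (n + 2) = pw (sg s (n + 1)) (s (n + 1)) ++ sg s n := by
  simp only [sg, sigmaW, pw]

def uW (s : ℕ → ℕ) : ℕ → List ℕ
  | 0 => List.replicate (s 0 - 1) 0
  | (n + 1) => pw (sg s (n + 1)) (s (n + 1)) ++ uW s n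

lemma uW_inv (s : ℕ → ℕ) (n : ℕ) : (uW s n).reverse = uW s n ∧
    sg s n ++ uW s n = uW s n ++ (sg s n).reverse ∧
    sg s (n + 1) ++ uW s n = uW s n ++ (sg s (n + 1)).reverse := by
  induction n with
  | zero =>
    refine ⟨by simp [uW], ?_, ?_⟩
    · simp only [sg, sigmaW, uW, List.reverse_singleton]
      rw [← List.replicate_succ', List.singleton_append, ← List.replicate_succ]
    · simp [sg, sigmaW, uW]
  | succ n ih =>
    obtain ⟨h1, h2, h3⟩ := ih
    have h4 := pw_comm h3 (s (n + 1))
    refine ⟨?_, ?_, ?_⟩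
    · rw [uW, List.reverse_append, pw_reverse, h1, h4]
    · rw [uW, ← List.append_assoc, ← pw_succ, pw_succ', List.append_assoc, h3, List.append_assoc]
    · have h5 : sg s n ++ uW s (n + 1) = uW s n ++ (sg s (n + 2)).reverse := by
        rw [uW, h4, ← List.append_assoc, h2, sg_rec, List.reverse_append, pw_reverse,
          List.append_assoc]
      rw [sg_rec, List.append_assoc, h5, ← List.append_assoc, ← sg_rec, ← uW]

lemma uW_shift (s : ℕ → ℕ) (n t : ℕ) :
    pw (sg s (n + 1)) t ++ uW s n = uW s n ++ pw (sg s (n + 1)).reverse t :=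
  pw_comm (uW_inv s n).2.2 t

lemma uW_pal (s : ℕ → ℕ) (n t : ℕ) : (pw (sg s (n + 1)) t ++ uW s n).Palindrome := by
  rw [List.Palindrome.iff_reverse_eq, List.reverse_append, pw_reverse, (uW_inv s n).1, uW_shift]

lemma uW_pre (s : ℕ → ℕ) (n t : ℕ) (ht : t ≤ s (n + 1)) :
    pw (sg s (n + 1)) t ++ uW s n <+: uW s (n + 1) := by
  rw [uW, uW_shift, uW_shift, List.prefix_append_right_inj]
  obtain ⟨r, hr⟩ := Nat.exists_eq_add_of_le ht
  rw [hr, pw_add]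
  exact List.prefix_append _ _

lemma uW_mono (s : ℕ → ℕ) {n k : ℕ} (h : n ≤ k) : uW s n <+: uW s k := by
  induction k, h using Nat.le_induction with
  | base => exact List.prefix_rfl
  | succ k _ ih =>
    refine ih.trans ?_
    simpa [pw_zero] using uW_pre s k 0 (Nat.zero_le _)

def qL (s : ℕ → ℕ) (n : ℕ) : ℕ := (sg s n).length
def UL (s : ℕ → ℕ) (n : ℕ) : ℕ := (uW s n).length

lemma qL_rec (s : ℕ → ℕ) (n : ℕ) : qL s (n + 2) = s (n + 1) * qL s (n + 1) + qL s n := by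
  simp only [qL]; rw [sg_rec, List.length_append, pw_length]

lemma qL_zero (s : ℕ → ℕ) : qL s 0 = 1 := by simp [qL, sigmaW]
lemma qL_one (s : ℕ → ℕ) : qL s 1 = s 0 - 1 + 1 := by simp [qL, sigmaW]
lemma UL_zero (s : ℕ → ℕ) : UL s 0 = s 0 - 1 := by simp [UL, uW]
lemma UL_succ (s : ℕ → ℕ) (n : ℕ) : UL s (n + 1) = s (n + 1) * qL s (n + 1) + UL s n := by
  simp only [UL, qL, uW, List.length_append, pw_length]

lemma UL_eq (s : ℕ → ℕ) (n : ℕ) : UL s n + 2 = qL s (n + 1) + qL s n := by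
  induction n with
  | zero => rw [UL_zero, qL_one, qL_zero]
  | succ n ih => rw [UL_succ, qL_rec]; omega

lemma qL_pos (s : ℕ → ℕ) (hs : ∀ k, 0 < s k) (n : ℕ) : 0 < qL s n := by
  induction n using Nat.twoStepInduction with
  | zero => rw [qL_zero]; omega
  | one => rw [qL_one]; omega
  | more n h1 h2 => rw [qL_rec]; omega

def lastL (n : ℕ) : ℕ := if Even n then 0 else 1

lemma sg_last (s : ℕ → ℕ) (n : ℕ) : ∃ l, sg s n = l ++ [lastL n] := by
  induction n using Nat.twoStepInduction with
  | zero => exact ⟨[], by simp [sigmaW, lastL]⟩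
  | one => exact ⟨List.replicate (s 0 - 1) 0, by simp [sigmaW, lastL]⟩
  | more n h1 h2 =>
    obtain ⟨l, hl⟩ := h1
    refine ⟨pw (sg s (n + 1)) (s (n + 1)) ++ l, ?_⟩
    rw [sg_rec, hl, List.append_assoc]
    simp [lastL, Nat.even_add]

lemma pref_length (c : ℕ → ℕ) (n : ℕ) : (pref c n).length = n := by simp [pref]

lemma pref_prefix {c : ℕ → ℕ} {l : List ℕ} {n : ℕ} (h : l <+: pref c n) :
    pref c l.length = l := by
  have hl : l.length ≤ n := by simpa [pref] using h.length_le
  rw [List.prefix_iff_eq_take.1 h]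
  simp [pref, List.take_range, ← List.map_take, hl]

lemma pref_get {c : ℕ → ℕ} {l l1 l2 : List ℕ} {x : ℕ} (h : pref c l.length = l)
    (hl : l = l1 ++ x :: l2) : c l1.length = x := by
  have h1 : l[l1.length]? = some x := by rw [hl]; simp
  rw [← h] at h1
  have : l1.length < l.length := by rw [hl]; simp
  simpa [pref, this] using h1

section
variable {c s : ℕ → ℕ} (hs : ∀ k, 0 < s k)
  (hc : ∀ n ≥ 1, pref c (sigmaW 0 1 s n).length = sigmaW 0 1 s n)
include hs hc

lemma c_uW (n : ℕ) : pref c (UL s n) = uW s n := by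
  have h1 : uW s n <+: sg s (UL s n + n + 1) := by
    apply List.prefix_of_prefix_length_le (l₃ := uW s (UL s n + n + 1))
    · exact uW_mono s (by omega)
    · rw [uW]
      obtain ⟨r, hr⟩ := Nat.exists_eq_add_of_lt (hs (UL s n + n + 1))
      rw [hr, pw_succ, List.append_assoc]
      exact List.prefix_append _ _
    · have := rec_ge (qL_pos s hs) (qL_rec s) (fun k => hs (k + 1)) (UL s n + n)
      simp only [qL, UL] at this ⊢
      omega
  rw [sg, ← hc _ (by omega)] at h1
  exact pref_prefix h1

lemma c_pal (n t : ℕ) (ht : t ≤ s (n + 1)) : palP c (UL s n + t * qL s (n + 1)) := by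
  have h1 := uW_pre s n t ht
  rw [← c_uW hs hc (n + 1)] at h1
  have h2 := pref_prefix h1
  have h3 : (pw (sg s (n + 1)) t ++ uW s n).length = UL s n + t * qL s (n + 1) := by
    rw [List.length_append, pw_length, UL, qL, Nat.add_comm]
  unfold palP
  rw [← h3, h2]
  exact uW_pal s n t

lemma c_let (n t : ℕ) (ht : t < s (n + 1)) : c (UL s n + t * qL s (n + 1)) = lastL (n + 1) := by
  have h1 := uW_pre s n (t + 1) ht
  rw [← c_uW hs hc (n + 1)] at h1
  have h2 := pref_prefix h1
  obtain ⟨l, hl⟩ := sg_last s (n + 1)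
  have h3 : pw (sg s (n + 1)) (t + 1) ++ uW s n
      = (pw (sg s (n + 1)) t ++ uW s n) ++ lastL (n + 1) :: l.reverse := by
    rw [uW_shift, pw_succ', ← List.append_assoc, ← uW_shift]
    congr 1
    rw [hl]; simp
  have h4 := pref_get h2 h3
  have h5 : (pw (sg s (n + 1)) t ++ uW s n).length = UL s n + t * qL s (n + 1) := by
    rw [List.length_append, pw_length, UL, qL, Nat.add_comm]
  rwa [h5] at h4

lemma c_zero (r : ℕ) (hr : r < UL s 0) : c r = 0 := by
  have h := c_uW hs hc 0
  have h1 : uW s 0 = List.replicate r 0 ++ 0 :: List.replicate (UL s 0 - r - 1) 0 := by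
    rw [← List.replicate_succ, ← List.replicate_add, uW]
    congr 1
    rw [UL_zero] at hr ⊢; omega
  have := pref_get h h1
  simpa using this

lemma c_pal0 (m : ℕ) (hm : m ≤ UL s 0) : palP c m := by
  rw [palP_iff]
  intro i hi
  rw [c_zero hs hc _ (by omega), c_zero hs hc _ (by omega)]

/-- no palindromic prefix strictly inside the gaps -/
lemma c_gap (n : ℕ) : ∀ t, t < s (n + 1) → ∀ m, palP c m → UL s n + t * qL s (n + 1) < m →
    UL s n + (t + 1) * qL s (n + 1) ≤ m := by
  induction n using Nat.strong_induction_on with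
  | _ n IH =>
  -- classification of the earlier palindromes
  have hcl : ∀ k, k < n → ∀ m, palP c m → UL s k ≤ m → m < UL s (k + 1) →
      c m = lastL (k + 1) ∧ m + qL s (k + 1) ≤ UL s (k + 1) := by
    intro k hk m hm h1 h2
    have : ∀ t, t ≤ s (k + 1) → (m < UL s k + t * qL s (k + 1)) →
        ∃ t', t' < s (k + 1) ∧ m = UL s k + t' * qL s (k + 1) := by
      intro t
      induction t with
      | zero => intro _ h; omega
      | succ t ih =>
        intro ht h
        rcases lt_trichotomy m (UL s k + t * qL s (k + 1)) with h3 | h3 | h3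
        · exact ih (by omega) h3
        · exact ⟨t, by omega, h3⟩
        · have := IH k hk t (by omega) m hm h3
          omega
    obtain ⟨t', ht', rfl⟩ := this (s (k + 1)) le_rfl (by rw [UL_succ] at h2; omega)
    refine ⟨c_let hs hc k t' ht', ?_⟩
    rw [UL_succ]
    have : (t' + 1) * qL s (k + 1) ≤ s (k + 1) * qL s (k + 1) := Nat.mul_le_mul_right _ ht'
    rw [Nat.add_mul] at this
    omega
  intro t
  induction t with
  | zero =>
    intro ht m hm hlt
    by_contra hcon
    push Not at hcon
    simp only [Nat.zero_mul, Nat.add_zero, Nat.zero_add, Nat.one_mul] at hlt hcon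
    have hU := UL_eq s n
    have hq := qL_pos s hs n
    have hN := c_pal hs hc n 0 (Nat.zero_le _)
    have hL := c_let hs hc n 0 ht
    simp only [Nat.zero_mul, Nat.add_zero] at hN hL
    have hlastU : palP c (2 * UL s n - m) := pal_refl hN hm hlt.le ?_
    swap
    · cases n with
      | zero => rw [qL_zero, ] at hU; omega
      | succ n => omega
    have hr : c (2 * UL s n - m) = c (UL s n) := by
      have := pal_period hN hm hlt.le (2 * UL s n - m) (by omega)
      rw [← this]; congr 1; omega
    rw [hL] at hr
    set r := 2 * UL s n - m with hrdef
    cases n with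
    | zero =>
      rw [c_zero hs hc r (by omega)] at hr
      simp [lastL] at hr
    | succ n =>
      have hne : lastL (n + 1) ≠ lastL (n + 1 + 1) := by
        simp only [lastL, Nat.even_add_one]
        by_cases h : Even n <;> simp [h]
      have h1 : r < UL s n := by
        by_contra h
        push Not at h
        have := (hcl n (by omega) r hlastU h (by omega)).1
        exact hne (this.symm.trans hr)
      have h2 : r + qL s n ≤ UL s n := by
        cases n with
        | zero => rw [qL_zero]; omega
        | succ n =>
          by_cases h : UL s n ≤ r
          · exact (hcl n (by omega) r hlastU h h1).2
          · rw [UL_succ]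
            have : 1 * qL s (n + 1) ≤ s (n + 1) * qL s (n + 1) :=
              Nat.mul_le_mul_right _ (hs _)
            omega
      have h3 := UL_succ s n
      have h4 : qL s (n + 1 + 1) = s (n + 1) * qL s (n + 1) + qL s n := qL_rec s n
      omega
  | succ t ih =>
    intro ht m hm hlt
    by_contra hcon
    push Not at hcon
    have hN := c_pal hs hc n (t + 1) ht.le
    have e1 : (t + 1 + 1) * qL s (n + 1) = (t + 1) * qL s (n + 1) + qL s (n + 1) := by ring
    have e2 : (t + 1) * qL s (n + 1) = t * qL s (n + 1) + qL s (n + 1) := by ring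
    have hr := pal_refl hN hm hlt.le (by omega)
    have := ih (by omega) _ hr (by omega)
    omega

/-- classification -/
lemma c_class (K m : ℕ) (hm : palP c m) (hK : UL s K ≤ m) :
    ∃ k, K ≤ k ∧ UL s k ≤ m ∧ palP c (m + qL s (k + 1)) := by
  have hlarge : ∃ k, m < UL s (k + 1) := by
    refine ⟨m + 2, ?_⟩
    have h1 := rec_ge (qL_pos s hs) (qL_rec s) (fun k => hs (k + 1)) (m + 2 + 1)
    have h2 := UL_eq s (m + 2 + 1)
    have := qL_pos s hs (m + 2 + 1)
    omega
  obtain ⟨k, hkK, hk1, hk2⟩ : ∃ k, K ≤ k ∧ UL s k ≤ m ∧ m < UL s (k + 1) := by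
    by_contra hcon
    push Not at hcon
    obtain ⟨k0, hk0⟩ := hlarge
    have : ∀ j, UL s (K + j) ≤ m := by
      intro j
      induction j with
      | zero => exact hK
      | succ j ih => exact hcon (K + j) (by omega) ih
    have h1 := this (k0 + 1)
    have h2 : UL s (k0 + 1) ≤ UL s (K + (k0 + 1)) := (uW_mono s (by omega)).length_le
    omega
  refine ⟨k, hkK, hk1, ?_⟩
  have : ∀ t, t ≤ s (k + 1) → (m < UL s k + t * qL s (k + 1)) →
      ∃ t', t' < s (k + 1) ∧ m = UL s k + t' * qL s (k + 1) := by
    intro t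
    induction t with
    | zero => intro _ h; omega
    | succ t ih =>
      intro ht h
      rcases lt_trichotomy m (UL s k + t * qL s (k + 1)) with h3 | h3 | h3
      · exact ih (by omega) h3
      · exact ⟨t, by omega, h3⟩
      · have := c_gap hs hc k t (by omega) m hm h3
        omega
  obtain ⟨t', ht', rfl⟩ := this (s (k + 1)) le_rfl (by rw [UL_succ] at hk2; omega)
  have := c_pal hs hc k (t' + 1) ht'
  rwa [Nat.add_mul, Nat.one_mul, ← Nat.add_assoc] at this

lemma c_next (m : ℕ) (hm : palP c m) : ∃ m', palP c m' ∧ m < m' ∧ m' ≤ 2 * m + 1 := by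
  by_cases h : m < UL s 0
  · exact ⟨m + 1, c_pal0 hs hc _ h, by omega, by omega⟩
  push Not at h
  obtain ⟨k, _, h1, h2⟩ := c_class hs hc 0 m hm h
  have := qL_pos s hs (k + 1)
  refine ⟨_, h2, by omega, ?_⟩
  have h3 := UL_eq s k
  have h4 := qL_pos s hs k
  omega

lemma c_abundant : Abundant c :=
  abundant_of (infinite_of_step fun n hn => by
    obtain ⟨n', a, b, _⟩ := c_next hs hc n hn; exact ⟨n', a, b⟩) (c_next hs hc)

lemma c_ladder : Ladder c (fun k => s (k + 1)) (qL s) (UL s) (-2) where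
  Dpos := qL_pos s hs
  rec' := qL_rec s
  mpos := fun k => hs (k + 1)
  hN := fun k => by have := UL_eq s k; omega
  mem := fun k => by simpa using c_pal hs hc k 0 (Nat.zero_le _)
  gap := fun k n hn hlt => by
    have := c_gap hs hc k 0 (hs _) n hn (by simpa using hlt)
    simpa using this
  cover := c_class hs hc

end

lemma exists_sturm (s : ℕ → ℕ) (hs : ∀ k, 0 < s k) :
    ∃ c : ℕ → ℕ, ∀ n ≥ 1, pref c (sigmaW 0 1 s n).length = sigmaW 0 1 s n := by
  have hmono : ∀ n k, 1 ≤ n → n ≤ k → sg s n <+: sg s k := by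
    intro n k hn hk
    induction k, hk using Nat.le_induction with
    | base => exact List.prefix_rfl
    | succ k hk ih =>
      refine ih.trans ?_
      obtain ⟨j, rfl⟩ : ∃ j, k = j + 1 := ⟨k - 1, by omega⟩
      rw [sg_rec]
      obtain ⟨r, hr⟩ := Nat.exists_eq_add_of_lt (hs (j + 1))
      rw [hr, pw_succ, List.append_assoc]
      exact List.prefix_append _ _
  have hlen : ∀ k, k ≤ (sg s (k + 1)).length :=
    rec_ge (qL_pos s hs) (qL_rec s) (fun k => hs (k + 1))
  refine ⟨fun i => (sg s (i + 2)).getD i 0, fun n hn => ?_⟩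
  apply List.ext_getElem
  · simp [pref]
  · intro i h1 h2
    simp only [pref, List.getElem_map, List.getElem_range]
    have h3 : i < (sg s (i + 2)).length := hlen (i + 1)
    rw [List.getD_eq_getElem _ _ h3]
    have a := hmono n (n + i + 2) hn (by omega)
    have b := hmono (i + 2) (n + i + 2) (by omega) (by omega)
    rw [a.getElem h2, b.getElem h3]

lemma real_caseA {y A B N Nx T J' : ℝ} (hA0 : 0 < N) (hy : y * y < 3) (hy1 : 1 < y)
    (hAB : N - B = B - A) (hJ' : J' ≤ A) (hJT : (2 - y) * T ≤ J') (hT : Nx ≤ T)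
    (hF : 2 * N - Nx ≤ N - B) (hNx : Nx ≤ y * N) : False := by
  have hy2 : y < 2 := by nlinarith
  have h1 : (2 - y) * Nx ≤ (2 - y) * T := mul_le_mul_of_nonneg_left hT (by linarith)
  have h2 : y * ((2 - y) * N) ≤ y * (2 * N - Nx) := by
    apply mul_le_mul_of_nonneg_left _ (by linarith)
    linarith
  have h3 : 0 < (3 - y * y) * N := mul_pos (by linarith) hA0
  nlinarith

lemma real_caseB {y A B N Nx T J' : ℝ} (hA0 : 0 < N) (hy : y * y < 3) (hy1 : 1 < y)
    (hJ' : J' ≤ A) (hJT : (2 - y) * T ≤ J') (hT : Nx ≤ T)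
    (hJA : 2 * N - Nx ≤ A) (hF : 2 * B - N ≤ B - A) (hNB : N ≤ y * B) : False := by
  have hy2 : y < 2 := by nlinarith
  have h1 : (2 - y) * (2 * N - A) ≤ (2 - y) * T :=
    mul_le_mul_of_nonneg_left (by linarith) (by linarith)
  have h2 : (2 - y) * (2 * N) ≤ (3 - y) * A := by nlinarith
  have h3 : (3 - y) * A ≤ (3 - y) * (N - B) :=
    mul_le_mul_of_nonneg_left (by linarith) (by linarith)
  have h4 : y * ((2 - y) * (2 * N)) ≤ y * ((3 - y) * (N - B)) :=
    mul_le_mul_of_nonneg_left (by linarith) (by linarith)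
  have h5 : (3 - y) * (y * (N - B)) ≤ (3 - y) * ((y - 1) * N) :=
    mul_le_mul_of_nonneg_left (by nlinarith) (by linarith)
  have h6 : 0 < (3 - y * y) * N := mul_pos (by linarith) hA0
  nlinarith

lemma main_ladder {w : ℕ → ℕ} (hδ : delta w < ENNReal.ofReal (Real.sqrt 3)) :
    delta w = 1 ∨ ∃ (m D N : ℕ → ℕ) (C : ℤ), Ladder w m D N C := by
  obtain ⟨a, ha1, ha2⟩ := exists_between hδ
  have hat : a ≠ ⊤ := ne_top_of_lt ha2
  obtain ⟨y, hy⟩ : ∃ y : ℝ, y = a.toReal := ⟨_, rfl⟩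
  have hay : a = ENNReal.ofReal y := by rw [hy, ENNReal.ofReal_toReal hat]
  rw [hay] at ha1 ha2
  have hyr := (ENNReal.ofReal_lt_ofReal_iff'.1 ha2).1
  have hy0 : 0 < y := ENNReal.ofReal_pos.1 (lt_of_le_of_lt bot_le ha1)
  have hyy : y * y < 3 := by
    have := Real.mul_self_sqrt (show (0 : ℝ) ≤ 3 by norm_num)
    nlinarith
  have hylt2 : y < 2 := by nlinarith
  clear hy hay ha2 hyr hat
  obtain ⟨hinf, M, hM⟩ := delta_A hy0 ha1
  clear ha1
  set n : ℕ → ℕ := Nat.nth (palP w) with hn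
  have hmono : StrictMono n := Nat.nth_strictMono hinf
  have hmem : ∀ i, palP w (n i) := Nat.nth_mem_of_infinite hinf
  have hid : ∀ j, j ≤ n j := fun j => hmono.le_apply
  have hlt : ∀ i, n i < n (i + 1) := fun i => hmono (Nat.lt_succ_self i)
  have hnext : ∀ i p, palP w p → n i < p → n (i + 1) ≤ p :=
    fun i p hp h => nth_succ_le hinf hp h
  have hprev : ∀ i p, palP w p → p < n (i + 1) → p ≤ n i := by
    intro i p hp h
    by_contra hc
    push Not at hc
    have := hnext i p hp hc
    omega
  have hidx : ∀ p, palP w p → ∃ i, n i = p := fun p hp => ⟨_, Nat.nth_count hp⟩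
  -- bounds
  have hF0r : ∀ i, M + 1 ≤ i → (n (i + 1) : ℝ) ≤ y * n i := by
    intro i hi
    obtain ⟨n', h1, h2, h3⟩ := hM (n i) (hmem i) (by have := hid i; omega)
    exact le_trans (by exact_mod_cast hnext i n' h1 h2) h3
  have hpos : ∀ i, M + 1 ≤ i → 0 < n i := fun i hi => by have := hid i; omega
  have hF0 : ∀ i, M + 1 ≤ i → n (i + 1) < 2 * n i := by
    intro i hi
    have h1 := hF0r i hi
    have h2 : (0 : ℝ) < n i := by exact_mod_cast hpos i hi
    have : (n (i + 1) : ℝ) < 2 * n i := by nlinarith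
    exact_mod_cast this
  have hy1 : 1 < y := by
    have h1 := hF0r (M + 1) le_rfl
    have h2 : (n (M + 1) : ℝ) < n (M + 1 + 1) := by exact_mod_cast hlt (M + 1)
    have h3 : (0 : ℝ) < n (M + 1) := by exact_mod_cast hpos (M + 1) le_rfl
    by_contra hc
    push Not at hc
    nlinarith
  have hrefl : ∀ i, M + 1 ≤ i → palP w (2 * n i - n (i + 1)) := fun i hi =>
    pal_refl (hmem i) (hmem (i + 1)) (hlt i).le (hF0 i hi).le
  obtain ⟨d, hd⟩ : ∃ d : ℕ → ℕ, ∀ i, n (i + 1) = n i + d i :=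
    ⟨fun i => n (i + 1) - n i, fun i => by have := hlt i; show _ = _ + (_ - _); omega⟩
  have hdpos : ∀ i, 0 < d i := fun i => by have := hlt i; have := hd i; omega
  have hF2 : ∀ i, M + 1 ≤ i → d i ≤ d (i + 1) := by
    intro i hi
    have h1 := hrefl (i + 1) (by omega)
    have h2 := hd i
    have h3 := hd (i + 1)
    have h4 := hprev i _ h1 (by have := hlt (i + 1); have := hpos (i + 1) (by omega); omega)
    omega
  have hF3 : ∀ i, M + 1 ≤ i → d i < d (i + 1) → n (i + 1) ≤ d i + d (i + 1) := by
    intro i hi hj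
    by_contra hc
    push Not at hc
    have e1 := hd i
    have e2 := hd (i + 1)
    have e0 := hdpos i
    have hpal : palP w (n (i + 1 + 1) - d i) := by
      apply pal_of_period (hmem (i + 1 + 1)) (by omega)
      intro x hx
      rw [show n (i + 1 + 1) - (n (i + 1 + 1) - d i) = d i by omega]
      have p1 := pal_period (hmem i) (hmem (i + 1)) (by omega)
      have p2 := pal_period (hmem (i + 1)) (hmem (i + 1 + 1)) (by omega)
      rw [show n (i + 1) - n i = d i by omega] at p1
      rw [show n (i + 1 + 1) - n (i + 1) = d (i + 1) by omega] at p2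
      by_cases hx1 : x < n i
      · exact p1 x hx1
      · have q1 := p2 (x - d (i + 1)) (by omega)
        have q2 := p2 (x + d i - d (i + 1)) (by omega)
        have q3 := p1 (x - d (i + 1)) (by omega)
        rw [show x - d (i + 1) + d (i + 1) = x by omega] at q1
        rw [show x + d i - d (i + 1) + d (i + 1) = x + d i by omega] at q2
        rw [show x - d (i + 1) + d i = x + d i - d (i + 1) by omega] at q3
        rw [q2, q3, q1]
    have := hprev (i + 1) _ hpal (by omega)
    omega
  -- jumps
  set jump : ℕ → Prop := fun i => d (i - 1) < d i with hjump
  have hconst : ∀ i i', M + 2 ≤ i → (∀ l, i < l → l < i' → ¬ jump l) →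
      ∀ l, i ≤ l → l < i' → d l = d i := by
    intro i i' hi hno l hil
    induction l, hil using Nat.le_induction with
    | base => intro _; rfl
    | succ l hl ih =>
      intro h
      rw [← ih (by omega)]
      have h1 := hno (l + 1) (by omega) h
      simp only [hjump, Nat.add_sub_cancel] at h1
      have h2 := hF2 l (by omega)
      omega
  have hmax : ∀ i i', M + 4 ≤ i → jump i → i < i' → jump i' →
      (∀ l, i < l → l < i' → ¬ jump l) → d i' + n (i - 1) = n i' := by
    intro i i' hi hji hii hji' hno
    obtain ⟨a, rfl⟩ : ∃ a, i = a + 2 := ⟨i - 2, by omega⟩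
    obtain ⟨b, rfl⟩ : ∃ b, i' = b + 1 := ⟨i' - 1, by omega⟩
    have hdb : d b = d (a + 2) := hconst _ _ (by omega) hno b (by omega) (by omega)
    simp only [hjump, Nat.add_sub_cancel] at hji'
    have hji2 : d (a + 1) < d (a + 2) := hji
    show d (b + 1) + n (a + 1) = n (b + 1)
    have hP' := hrefl (b + 1) (by omega)
    have hdb1 := hd (b + 1)
    have hlt' := hF0 (b + 1) (by omega)
    obtain ⟨J', hJ'⟩ : ∃ J', J' = 2 * n (b + 1) - n (b + 1 + 1) := ⟨_, rfl⟩
    rw [← hJ'] at hP'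
    have hJle : J' ≤ d b := by
      have := hF3 b (by omega) hji'
      omega
    have ha2 := hF0 (a + 2) (by omega)
    have hda0 : n (a + 1) = n a + d a := hd a
    have hda1 : n (a + 2) = n (a + 1) + d (a + 1) := hd (a + 1)
    have hda2 : n (a + 2 + 1) = n (a + 2) + d (a + 2) := hd (a + 2)
    have hJ1 : J' ≤ n (a + 1) := hprev (a + 1) J' hP' (by show J' < n (a + 2); omega)
    rcases hJ1.eq_or_lt with heq | hlt1
    · omega
    exfalso
    have hJ2 : J' ≤ n a := hprev a J' hP' hlt1
    -- real versions
    have rT : (n (b + 1 + 1) : ℝ) ≤ y * n (b + 1) := hF0r (b + 1) (by omega)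
    have rJ' : (J' : ℝ) = 2 * n (b + 1) - n (b + 1 + 1) := by
      have : J' + n (b + 1 + 1) = 2 * n (b + 1) := by omega
      have : ((J' + n (b + 1 + 1) : ℕ) : ℝ) = (2 * n (b + 1) : ℕ) := by rw [this]
      push_cast at this; linarith
    have rJT : (2 - y) * (n (b + 1) : ℝ) ≤ J' := by linarith
    have rTT : (n (a + 2 + 1) : ℝ) ≤ n (b + 1) := by
      exact_mod_cast hmono.monotone (show a + 2 + 1 ≤ b + 1 by omega)
    have rJA : (J' : ℝ) ≤ n a := by exact_mod_cast hJ2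
    have rN0 : (0 : ℝ) < n (a + 2) := by exact_mod_cast hpos (a + 2) (by omega)
    have rNx := hF0r (a + 2) (by omega)
    have rNB : (n (a + 2) : ℝ) ≤ y * n (a + 1) := hF0r (a + 1) (by omega)
    have f3 : n (a + 2) ≤ d (a + 1) + d (a + 2) := hF3 (a + 1) (by omega) hji2
    have r0 : (n (a + 1) : ℝ) = n a + d a := by exact_mod_cast hda0
    have r1 : (n (a + 2) : ℝ) = n (a + 1) + d (a + 1) := by exact_mod_cast hda1
    have r2 : (n (a + 2 + 1) : ℝ) = n (a + 2) + d (a + 2) := by exact_mod_cast hda2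
    have rf3 : (n (a + 2) : ℝ) ≤ d (a + 1) + d (a + 2) := by exact_mod_cast f3
    rcases (hF2 a (by omega)).eq_or_lt with hc | hc
    · have rc : (d a : ℝ) = d (a + 1) := by exact_mod_cast hc
      exact real_caseA (y := y) (A := n a) (B := n (a + 1)) (N := n (a + 2)) (Nx := n (a + 2 + 1))
        (T := n (b + 1)) (J' := J') rN0 hyy hy1 (by linarith) rJA rJT rTT (by linarith) rNx
    · have f4 : n (a + 1) ≤ d a + d (a + 1) := hF3 a (by omega) hc
      have rf4 : (n (a + 1) : ℝ) ≤ d a + d (a + 1) := by exact_mod_cast f4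
      have hlt3 : n (a + 2) < 2 * n (a + 1) := hF0 (a + 1) (by omega)
      have hJA : 2 * n (a + 2) - n (a + 2 + 1) ≤ n a :=
        hprev a _ (hrefl (a + 2) (by omega)) (by omega)
      have rJA2 : 2 * (n (a + 2) : ℝ) - n (a + 2 + 1) ≤ n a := by
        have : 2 * n (a + 2) ≤ n a + n (a + 2 + 1) := by omega
        have : ((2 * n (a + 2) : ℕ) : ℝ) ≤ (n a + n (a + 2 + 1) : ℕ) := by exact_mod_cast this
        push_cast at this; linarith
      exact real_caseB (y := y) (A := n a) (B := n (a + 1)) (N := n (a + 2)) (Nx := n (a + 2 + 1))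
        (T := n (b + 1)) (J' := J') rN0 hyy hy1 rJA rJT rTT rJA2 (by linarith) rNB
  by_cases hfin : ∃ I, ∀ i, I ≤ i → ¬ jump i
  · left
    obtain ⟨I, hI⟩ := hfin
    apply delta_eq_one hinf (d (I + M + 2)) (n (I + M + 2))
    intro p hp hle
    obtain ⟨i, rfl⟩ := hidx p hp
    have hi : I + M + 2 ≤ i := hmono.le_iff_le.1 hle
    refine ⟨n (i + 1), hmem _, hlt i, ?_⟩
    rw [hd i, hconst (I + M + 2) (i + 1) (by omega) (fun l h1 h2 => hI l (by omega)) i hi (by omega)]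
  right
  push Not at hfin
  have hnx : ∀ i, ∃ i', i < i' ∧ jump i' ∧ ∀ l, i < l → l < i' → ¬ jump l := by
    intro i
    have hex : ∃ i', i < i' ∧ jump i' := by
      obtain ⟨i', h1, h2⟩ := hfin (i + 1)
      exact ⟨i', by omega, h2⟩
    refine ⟨Nat.find hex, (Nat.find_spec hex).1, (Nat.find_spec hex).2, ?_⟩
    intro l h1 h2 h3
    exact Nat.find_min hex h2 ⟨h1, h3⟩
  choose nx hnx1 hnx2 hnx3 using hnx
  obtain ⟨b, hb0, hbs⟩ : ∃ b : ℕ → ℕ, b 0 = nx (M + 4) ∧ ∀ k, b (k + 1) = nx (b k) :=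
    ⟨fun k => Nat.rec (nx (M + 4)) (fun _ x => nx x) k, rfl, fun _ => rfl⟩
  have hblt : ∀ k, b k < b (k + 1) := fun k => by rw [hbs]; exact hnx1 _
  have hbmono : StrictMono b := strictMono_nat_of_lt_succ hblt
  have hbge : ∀ k, M + 4 < b k := by
    intro k
    have h1 := hbmono.monotone (Nat.zero_le k)
    have h2 := hnx1 (M + 4)
    omega
  have hbj : ∀ k, jump (b k) := by
    intro k
    cases k with
    | zero => rw [hb0]; exact hnx2 _
    | succ k => rw [hbs]; exact hnx2 _
  have hbno : ∀ k l, b k < l → l < b (k + 1) → ¬ jump l := by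
    intro k l h1 h2
    rw [hbs] at h2
    exact hnx3 _ l h1 h2
  have hbd : ∀ k l, b k ≤ l → l < b (k + 1) → d l = d (b k) := fun k l h1 h2 =>
    hconst (b k) (b (k + 1)) (by have := hbge k; omega) (hbno k) l h1 h2
  have hbn : ∀ k t, b k + t ≤ b (k + 1) → n (b k + t) = n (b k) + t * d (b k) := by
    intro k t
    induction t with
    | zero => intro _; simp
    | succ t ih =>
      intro h
      rw [← Nat.add_assoc, hd, ih (by omega), hbd k (b k + t) (by omega) (by omega)]
      ring
  obtain ⟨D, hD0, hDs⟩ : ∃ D : ℕ → ℕ, D 0 = d (b 0 - 1) ∧ ∀ k, D (k + 1) = d (b k) :=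
    ⟨fun k => Nat.casesOn k (d (b 0 - 1)) (fun k => d (b k)), rfl, fun _ => rfl⟩
  have hDk : ∀ k, d (b k - 1) = D k := by
    intro k
    cases k with
    | zero => exact hD0.symm
    | succ k =>
      have := hblt k
      rw [hDs, hbd k _ (by omega) (by omega)]
  have hNrec : ∀ k, n (b (k + 1)) = n (b k) + (b (k + 1) - b k) * D (k + 1) := by
    intro k
    have h1 := hblt k
    have h := hbn k (b (k + 1) - b k) (by omega)
    rw [show b k + (b (k + 1) - b k) = b (k + 1) by omega] at h
    rw [h, hDs]
  have hDrec : ∀ k, D (k + 2) = (b (k + 1) - b k) * D (k + 1) + D k := by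
    intro k
    have h1 := hmax (b k) (b (k + 1)) (hbge k).le (hbj k) (hblt k) (hbj _) (hbno k)
    have h2 := hNrec k
    have h3 := hd (b k - 1)
    have := hbge k
    rw [show b k - 1 + 1 = b k by omega, hDk] at h3
    have h4 : D (k + 2) = d (b (k + 1)) := hDs (k + 1)
    omega
  refine ⟨fun k => b (k + 1) - b k, D, fun k => n (b k), (n (b 0) : ℤ) - D 1 - D 0, ?_⟩
  constructor
  · intro k
    rw [← hDk]; exact hdpos _
  · exact hDrec
  · intro k
    have := hblt k
    show 0 < b (k + 1) - b k
    omega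
  · intro k
    show ((n (b k) : ℕ) : ℤ) = _
    induction k with
    | zero => simp only [Nat.zero_add]; ring
    | succ k ih =>
      have h1 := hNrec k
      have h2 : D (k + 1 + 1) = _ := hDrec k
      omega
  · exact fun k => hmem _
  · intro k p hp hlt'
    have h1 := hnext (b k) p hp hlt'
    rw [hd, ← hDs] at h1
    exact h1
  · intro K p hp hle
    obtain ⟨i, rfl⟩ := hidx p hp
    have hi : b K ≤ i := hmono.le_iff_le.1 hle
    obtain ⟨k, hk, h1, h2⟩ : ∃ k, K ≤ k ∧ b k ≤ i ∧ i < b (k + 1) := by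
      by_contra hcon
      push Not at hcon
      have : ∀ j, b (K + j) ≤ i := by
        intro j
        induction j with
        | zero => exact hi
        | succ j ih => exact hcon (K + j) (by omega) ih
      have h1 := this (i + 1)
      have h2 : K + (i + 1) ≤ b (K + (i + 1)) := hbmono.le_apply
      omega
    refine ⟨k, hk, hmono.monotone h1, ?_⟩
    rw [hDs, ← hbd k i h1 h2, ← hd]
    exact hmem _

lemma lower (x : ENNReal) (hx : x ∈ Set.Icc 1 (ENNReal.ofReal (Real.sqrt 3)))
    (h : ∃ w : ℕ → ℕ, delta w = x) : (∃ w : ℕ → ℕ, PerPal w ∧ delta w = x) ∨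
        (∃ c : ℕ → ℕ, IsCharSturmian c ∧ delta c = x) := by
  obtain ⟨w, rfl⟩ := h
  rcases hx.2.lt_or_eq with hlt | heq
  · rcases main_ladder hlt with h1 | ⟨m, D, N, C, hL⟩
    · exact Or.inl ⟨_, perPal_const, by rw [delta_const, h1]⟩
    · right
      obtain ⟨s, hs0, hss⟩ : ∃ s : ℕ → ℕ, s 0 = 1 ∧ ∀ k, s (k + 1) = m k :=
        ⟨fun k => Nat.casesOn k 1 m, rfl, fun _ => rfl⟩
      have hs : ∀ k, 0 < s k := by
        intro k
        cases k with
        | zero => omega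
        | succ k => rw [hss]; exact hL.mpos k
      obtain ⟨c, hc⟩ := exists_sturm s hs
      refine ⟨c, ⟨s, hs, hc⟩, ?_⟩
      have h2 := c_ladder hs hc
      simp only [hss] at h2
      exact hL.delta_eq h2 (ne_top_of_lt hlt)
  · right
    rw [heq]
    obtain ⟨s, hs0, hss⟩ : ∃ s : ℕ → ℕ, s 0 = 1 ∧ ∀ k, s (k + 1) = if Even k then 2 else 1 :=
      ⟨fun k => Nat.casesOn k 1 (fun k => if Even k then 2 else 1), rfl, fun _ => rfl⟩
    have hs : ∀ k, 0 < s k := by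
      intro k
      cases k with
      | zero => omega
      | succ k => rw [hss]; split_ifs <;> omega
    obtain ⟨c, hc⟩ := exists_sturm s hs
    refine ⟨c, ⟨s, hs, hc⟩, ?_⟩
    have h2 := c_ladder hs hc
    simp only [hss] at h2
    exact delta_sqrt3 h2

lemma upper (x : ENNReal)
    (h : (∃ w : ℕ → ℕ, PerPal w ∧ delta w = x) ∨
        (∃ c : ℕ → ℕ, IsCharSturmian c ∧ delta c = x)) :
    ∃ w : ℕ → ℕ, Abundant w ∧ delta w = x := by
  rcases h with ⟨w, h1, rfl⟩ | ⟨c, ⟨s, hs, hc⟩, rfl⟩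
  · exact ⟨_, abundant_const, by rw [delta_const, delta_perPal h1]⟩
  · exact ⟨c, c_abundant hs hc, rfl⟩

theorem stmt1 :
    ({x : ENNReal | (∃ w : ℕ → ℕ, PerPal w ∧ delta w = x) ∨
        (∃ c : ℕ → ℕ, IsCharSturmian c ∧ delta c = x)}
      ∩ Set.Icc 1 (ENNReal.ofReal (Real.sqrt 3))
      = {x : ENNReal | ∃ w : ℕ → ℕ, Abundant w ∧ delta w = x}
      ∩ Set.Icc 1 (ENNReal.ofReal (Real.sqrt 3))) ∧
    ({x : ENNReal | ∃ w : ℕ → ℕ, Abundant w ∧ delta w = x}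
      ∩ Set.Icc 1 (ENNReal.ofReal (Real.sqrt 3))
      = {x : ENNReal | ∃ w : ℕ → ℕ, delta w = x}
      ∩ Set.Icc 1 (ENNReal.ofReal (Real.sqrt 3))) := by

  refine ⟨?_, ?_⟩
  · ext x
    constructor
    · rintro ⟨h, hx⟩
      exact ⟨upper x h, hx⟩
    · rintro ⟨⟨w, _, h⟩, hx⟩
      exact ⟨lower x hx ⟨w, h⟩, hx⟩
  · ext x
    constructor
    · rintro ⟨⟨w, _, h⟩, hx⟩
      exact ⟨⟨w, h⟩, hx⟩
    · rintro ⟨h, hx⟩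
      exact ⟨upper x (lower x hx h), hx⟩
end

section
/- Let w be an infinite word on an alphabet A, and let n' < n'' be two consecutive lengths of palindromic prefixes of w, i.e. the prefixes π' and π'' of w of lengths n' and n'' are palindromes and no prefix of w of length strictly between n' and n'' is a palindrome. Write π'' = π'ω. Then every prefix π of w which is a palindrome and satisfies n' ≤ |π| ≤ n' + n'' is of the form π = π'ω^t for some integer t ≥ 0. -/
theorem pal_iff_aux {A : Type*} (w : ℕ → A) (n : ℕ) :
    (pref w n).Palindrome ↔ ∀ i j, i + j + 1 = n → w i = w j := by
  rw [List.Palindrome.iff_reverse_eq]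
  constructor
  · intro h i j hij
    have := congrArg (fun l => l[i]?) h
    have e : n - 1 - i = j := by omega
    simp only [pref] at this
    rw [List.getElem?_reverse (by simp; omega)] at this
    have h1 : j < n := by omega
    have h2 : i < n := by omega
    simp [e, h1, h2] at this
    exact this.symm
  · intro h
    apply List.ext_getElem
    · simp
    · intro i h1 h2
      simp only [pref, List.length_map, List.length_range] at h2
      simp only [pref, List.getElem_reverse, List.getElem_map, List.getElem_range,
        List.length_map, List.length_range]
      exact h _ _ (by omega)

theorem pref_add_aux {A : Type*} (w : ℕ → A) (m k : ℕ) :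
    pref w (m + k) = pref w m ++ (List.range k).map (fun j => w (m + j)) := by
  simp [pref, List.range_add, Function.comp_def]

theorem stmt6 {A : Type*} (w : ℕ → A) (n' n'' : ℕ) (hlt : n' < n'')
    (hp' : (pref w n').Palindrome) (hp'' : (pref w n'').Palindrome)
    (hcons : ∀ m, n' < m → m < n'' → ¬ (pref w m).Palindrome)
    (π : List A) (hpal : π.Palindrome) (hpre : pref w π.length = π)
    (h1 : n' ≤ π.length) (h2 : π.length ≤ n' + n'') :
    ∃ t : ℕ, π = pref w n' ++ (List.replicate t ((pref w n'').drop n')).flatten := by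
  generalize hm : π.length = m at *
  subst hpre
  clear hm
  have hcons' := hcons
  obtain ⟨p, rfl⟩ : ∃ p, n'' = n' + p := ⟨n'' - n', by omega⟩
  have hp : 0 < p := by omega
  have hdrop : (pref w (n' + p)).drop n' = (List.range p).map (fun j => w (n' + j)) := by
    rw [pref_add_aux, List.drop_append_of_le_length (by simp [pref])]
    simp [pref]
  rw [hdrop]
  have key : ∀ t, (∀ i, i < n' + t * p → w i = w (i % p)) → (∀ i, i < n' + p → w i = w (i % p)) →
      pref w (n' + t * p) = pref w n' ++
        (List.replicate t ((List.range p).map (fun j => w (n' + j)))).flatten := by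
    intro t
    induction t with
    | zero => simp
    | succ t ih =>
      intro h h'
      have e : n' + (t + 1) * p = (n' + t * p) + p := by ring
      rw [e] at h ⊢
      rw [pref_add_aux, ih (fun i hi => h i (by omega)) h', List.replicate_succ',
        List.flatten_append, List.append_assoc]
      congr 2
      simp only [List.flatten_cons, List.flatten_nil, List.append_nil]
      apply List.map_congr_left
      intro j hj
      rw [List.mem_range] at hj
      rw [h _ (by omega), h' (n' + j) (by omega)]
      congr 1
      rw [show n' + t * p + j = n' + j + t * p by ring, Nat.add_mul_mod_self_right]
  have P' := (pal_iff_aux w _).1 hp'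
  have P'' := (pal_iff_aux w _).1 hp''
  have P := (pal_iff_aux w _).1 hpal
  have per : ∀ i, i < n' + p → w i = w (i % p) := by
    intro i
    induction i using Nat.strong_induction_on with
    | _ i ih =>
      intro hi
      by_cases hip : i < p
      · rw [Nat.mod_eq_of_lt hip]
      · have a := P' (i - p) (n' - 1 - (i - p)) (by omega)
        have b := P'' i (n' - 1 - (i - p)) (by omega)
        rw [b, ← a, ih (i - p) (by omega) (by omega), ← Nat.mod_eq_sub_mod (by omega)]
  by_cases hm1 : m = n'
  · exact ⟨0, by simp [hm1]⟩
  have hm2 : n' + p ≤ m := by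
    by_contra hc
    exact hcons m (by omega) (by omega) hpal
  obtain ⟨q, rfl⟩ : ∃ q, m = n' + p + q := ⟨m - (n' + p), by omega⟩
  have perq : ∀ i, i < n' + p → w (i + q) = w i := by
    intro i hi
    rw [P (i + q) (n' + p - 1 - i) (by omega), P'' i (n' + p - 1 - i) (by omega)]
  have hr : q % p = 0 := by
    by_contra hr
    have hrp := Nat.mod_lt q hp
    refine hcons (n' + p - q % p) (by omega) (by omega) ((pal_iff_aux w _).2 ?_)
    intro i j hij
    rw [P'' i (j + q % p) (by omega), per _ (by omega : j + q % p < n' + p), per j (by omega)]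
    have hjp := Nat.mod_lt j hp
    rw [← perq (j % p) (by omega), per (j % p + q) (by omega)]
    congr 1
    simp [Nat.add_mod]
  obtain ⟨k, rfl⟩ := Nat.dvd_of_mod_eq_zero hr
  refine ⟨k + 1, ?_⟩
  have e : n' + p + p * k = n' + (k + 1) * p := by ring
  rw [e]
  refine key _ ?_ per
  rw [← e]
  intro i hi
  by_cases hi' : i < n' + p
  · exact per i hi'
  · obtain ⟨j, rfl⟩ : ∃ j, i = j + p * k := ⟨i - p * k, by omega⟩
    rw [perq j (by omega), per j (by omega), Nat.add_mul_mod_self_left]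
end

section
/- Let w be an infinite word on an alphabet A, and let n₀ < n₁ < n₂ be three consecutive lengths of palindromic prefixes of w, i.e. the prefixes π₀, π₁, π₂ of w of lengths n₀, n₁, n₂ are palindromes and no prefix of w of length strictly between n₀ and n₂ other than π₁ is a palindrome. Then either there exists a finite word u with π₁ = π₀u and π₂ = π₁u (equivalently π₂ = π₁π₀⁻¹π₁, so n₂ = 2n₁ − n₀), or n₂ > n₀ + n₁. -/
theorem pref_pal_iff {A : Type*} (w : ℕ → A) (n : ℕ) :
    (pref w n).Palindrome ↔ ∀ i, i < n → w i = w (n - 1 - i) := by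
  rw [List.Palindrome.iff_reverse_eq]
  constructor
  · intro h i hi
    have h2 := congrArg (fun l => l[i]?) h
    simp only [pref] at h2
    rw [List.getElem?_reverse (by simpa using hi)] at h2
    have h3 : n - 1 - i < n := by omega
    simp [hi, h3] at h2
    exact h2.symm
  · intro h
    apply List.ext_getElem
    · simp [pref]
    · intro i h1 h2
      have hi : i < n := by simpa [pref] using h2
      simp [pref, List.getElem_reverse]
      exact (h i hi).symm

theorem pref_add {A : Type*} (w : ℕ → A) (a b : ℕ) :
    pref w (a + b) = pref w a ++ (List.range b).map (fun i => w (a + i)) := by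
  simp [pref, List.range_add, Function.comp_def]

theorem per_of_pal {A : Type*} (w : ℕ → A) (m d : ℕ)
    (h1 : (pref w m).Palindrome) (h2 : (pref w (m + d)).Palindrome) :
    ∀ i, i < m → w (i + d) = w i := by
  rw [pref_pal_iff] at h1 h2
  intro i hi
  rw [h2 (i + d) (by omega), h1 i hi]
  congr 1
  omega

theorem pal_of_per {A : Type*} (w : ℕ → A) (m d : ℕ)
    (h2 : (pref w (m + d)).Palindrome) (h : ∀ i, i < m → w (i + d) = w i) :
    (pref w m).Palindrome := by
  rw [pref_pal_iff] at h2 ⊢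
  intro i hi
  rw [h2 i (by omega), ← h (m - 1 - i) (by omega)]
  congr 1
  omega

theorem stmt7 {A : Type*} (w : ℕ → A) (n₀ n₁ n₂ : ℕ)
    (h01 : n₀ < n₁) (h12 : n₁ < n₂)
    (hp0 : (pref w n₀).Palindrome) (hp1 : (pref w n₁).Palindrome)
    (hp2 : (pref w n₂).Palindrome)
    (hcons : ∀ m, n₀ < m → m < n₂ → m ≠ n₁ → ¬ (pref w m).Palindrome) :
    (∃ u : List A, pref w n₁ = pref w n₀ ++ u ∧ pref w n₂ = pref w n₁ ++ u) ∨
      n₀ + n₁ < n₂ := by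
  by_cases hle : n₀ + n₁ < n₂
  · exact Or.inr hle
  left
  obtain ⟨p, rfl⟩ := Nat.exists_eq_add_of_lt h01
  obtain ⟨q, rfl⟩ := Nat.exists_eq_add_of_lt h12
  have P := per_of_pal w n₀ (p + 1) hp0 hp1
  have Q := per_of_pal w (n₀ + p + 1) (q + 1) hp1 hp2
  rcases lt_trichotomy p q with h | h | h
  · exfalso
    refine hcons (n₀ + q + 1) (by omega) (by omega) (by omega)
      (pal_of_per w _ (p + 1) ?_ ?_)
    · convert hp2 using 2
      omega
    · intro i hi
      by_cases hi0 : i < n₀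
      · exact P i hi0
      · obtain ⟨j, rfl⟩ : ∃ j, i = j + (q + 1) := ⟨i - (q + 1), by omega⟩
        rw [Q j (by omega), ← P j (by omega), ← Q (j + (p + 1)) (by omega)]
        congr 1
        omega
  · subst h
    refine ⟨_, pref_add w n₀ (p + 1), ?_⟩
    have := pref_add w (n₀ + p + 1) (p + 1)
    refine this.trans ?_
    congr 1
    apply List.map_congr_left
    intro i hi
    have hi := List.mem_range.1 hi
    rw [← Q (n₀ + i) (by omega)]
    congr 1
    omega
  · exfalso
    refine hcons (n₀ + p - q) (by omega) (by omega) (by omega)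
      (pal_of_per w _ (q + 1) ?_ ?_)
    · convert hp1 using 2
      omega
    · intro i hi
      exact Q i (by omega)
end
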